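/- arXiv:2509.09637 — 5 statements merged into one kernel-verified Lean document; each statement's English description precedes it below -/
import Mathlib

section
/- Let μ be an optimal solution of problem (W). Then for every pair (j,c) with W j c > 0, at least one of the following holds: ∑_{c'} μ j c' = κ j, or ∑_{j'} μ j' c = Q c. -/
/-- Feasibility for problem (W): nonnegativity, capacity constraints, and queue constraints. -/
def FeasW (n m : ℕ) (κ : Fin n → ℝ) (Q : Fin m → ℝ) (μ : Fin n → Fin m → ℝ) : Prop :=
  (∀ j c, 0 ≤ μ j c) ∧ (∀ j, ∑ c, μ j c ≤ κ j) ∧ (∀ c, ∑ j, μ j c ≤ Q c)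

/-- Lemma 2, part 2: at an optimal solution of problem (W), every entry with positive
weight saturates either its capacity (row) constraint or its queue (column) constraint. -/
theorem stmt_1 (n m : ℕ) (W : Fin n → Fin m → ℝ) (κ : Fin n → ℝ) (Q : Fin m → ℝ)
    (hκ : ∀ j, 0 ≤ κ j) (hQ : ∀ c, 0 ≤ Q c)
    (μ : Fin n → Fin m → ℝ)
    (hfeas : FeasW n m κ Q μ)
    (hopt : ∀ ν : Fin n → Fin m → ℝ, FeasW n m κ Q ν →
      ∑ j, ∑ c, W j c * ν j c ≤ ∑ j, ∑ c, W j c * μ j c) :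
    ∀ j c, 0 < W j c → (∑ c', μ j c' = κ j) ∨ (∑ j', μ j' c = Q c) := by
  intro j c hW
  by_contra hcon
  push Not at hcon
  obtain ⟨h1, h2⟩ := hcon
  obtain ⟨hn, hr, hc⟩ := hfeas
  have h1' := lt_of_le_of_ne (hr j) h1
  have h2' := lt_of_le_of_ne (hc c) h2
  obtain ⟨ε, hε, he1, he2⟩ : ∃ ε : ℝ, 0 < ε ∧ ε ≤ κ j - ∑ c', μ j c' ∧
      ε ≤ Q c - ∑ j', μ j' c :=
    ⟨min (κ j - ∑ c', μ j c') (Q c - ∑ j', μ j' c),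
      lt_min (by linarith) (by linarith), min_le_left _ _, min_le_right _ _⟩
  have key := hopt (fun a b => μ a b + if a = j then (if b = c then ε else 0) else 0) ?_
  · simp only [mul_add, Finset.sum_add_distrib] at key
    have h3 : ∑ a, ∑ b, W a b * (if a = j then (if b = c then ε else 0) else 0) = W j c * ε := by
      rw [Finset.sum_eq_single j]
      · simp
      · intro a _ ha
        simp [ha]
      · simp
    have := mul_pos hW hε
    linarith
  · refine ⟨fun a b => ?_, fun a => ?_, fun b => ?_⟩
    · have := hn a b
      dsimp only
      split_ifs <;> linarith
    · rw [Finset.sum_add_distrib]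
      by_cases ha : a = j
      · subst ha
        simp
        linarith
      · simpa [ha] using hr a
    · rw [Finset.sum_add_distrib]
      by_cases hb : b = c
      · subst hb
        simp
        linarith
      · simpa [hb] using hc b
end

section
/- Let μ be an optimal solution of problem (W). Then ∑_{j,c} W j c * μ j c = ∑_{j,c} max(W j c, 0) * μ j c, i.e., the optimal objective value is unchanged when W is replaced by its elementwise positive part. -/
/-- At an optimal solution of problem (W), the objective is unchanged when the weights
are replaced by their elementwise positive part. -/
theorem stmt_2 (n m : ℕ) (W : Fin n → Fin m → ℝ) (κ : Fin n → ℝ) (Q : Fin m → ℝ)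
    (hκ : ∀ j, 0 ≤ κ j) (hQ : ∀ c, 0 ≤ Q c)
    (μ : Fin n → Fin m → ℝ)
    (hfeas : FeasW n m κ Q μ)
    (hopt : ∀ ν : Fin n → Fin m → ℝ, FeasW n m κ Q ν →
      ∑ j, ∑ c, W j c * ν j c ≤ ∑ j, ∑ c, W j c * μ j c) :
    ∑ j, ∑ c, W j c * μ j c = ∑ j, ∑ c, max (W j c) 0 * μ j c := by
  obtain ⟨h0, h1, h2⟩ := hfeas
  apply le_antisymm
  · refine Finset.sum_le_sum fun j _ => Finset.sum_le_sum fun c _ => ?_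
    exact mul_le_mul_of_nonneg_right (le_max_left _ _) (h0 j c)
  · have hle : ∀ j c, (if W j c < 0 then 0 else μ j c) ≤ μ j c := by
      intro j c
      split_ifs
      · exact h0 j c
      · exact le_rfl
    have key := hopt (fun j c => if W j c < 0 then 0 else μ j c) ⟨?_, ?_, ?_⟩
    · refine le_trans (le_of_eq ?_) key
      refine Finset.sum_congr rfl fun j _ => Finset.sum_congr rfl fun c _ => ?_
      by_cases h : W j c < 0
      · simp [h, max_eq_right h.le]
      · simp [h, max_eq_left (not_lt.mp h)]
    · intro j c
      dsimp only
      split_ifs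
      · exact le_rfl
      · exact h0 j c
    · intro j
      exact le_trans (Finset.sum_le_sum fun c _ => hle j c) (h1 j)
    · intro c
      exact le_trans (Finset.sum_le_sum fun j _ => hle j c) (h2 c)
end

section
/- Suppose (μ, γ, σ) is a feasible solution of problem (T). Then the matrix μ' defined by μ' j c = μ j c if W j c > 0 and μ' j c = 0 otherwise is a feasible solution of problem (W). -/
/-- Feasibility for the optimal-transport problem (T), with slacks `γ` and `σ`. -/
def FeasT (n m : ℕ) (κ : Fin n → ℝ) (Q : Fin m → ℝ)
    (μ : Fin n → Fin m → ℝ) (γ : Fin n → ℝ) (σ : Fin m → ℝ) : Prop :=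
  (∀ j c, 0 ≤ μ j c) ∧ (∀ j, 0 ≤ γ j) ∧ (∀ c, 0 ≤ σ c) ∧
  (∀ j, (∑ c, μ j c) + γ j = κ j) ∧
  (∑ j, γ j = max ((∑ j, κ j) - (∑ c, Q c)) 0) ∧
  (∀ c, (∑ j, μ j c) + σ c = Q c) ∧
  (∑ c, σ c = max ((∑ c, Q c) - (∑ j, κ j)) 0)

/-- Any feasible solution of problem (T), restricted to entries with positive weight,
is feasible for problem (W). -/
theorem stmt_3 (n m : ℕ) (W : Fin n → Fin m → ℝ) (κ : Fin n → ℝ) (Q : Fin m → ℝ)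
    (hκ : ∀ j, 0 ≤ κ j) (hQ : ∀ c, 0 ≤ Q c)
    (μ : Fin n → Fin m → ℝ) (γ : Fin n → ℝ) (σ : Fin m → ℝ)
    (hfeas : FeasT n m κ Q μ γ σ) :
    FeasW n m κ Q (fun j c => if 0 < W j c then μ j c else 0) := by
  obtain ⟨h0, hγ, hσ, h1, -, h2, -⟩ := hfeas
  have hle : ∀ j c, (if 0 < W j c then μ j c else 0) ≤ μ j c := by
    intro j c
    split_ifs
    · exact le_rfl
    · exact h0 j c
  refine ⟨?_, ?_, ?_⟩
  · intro j c
    show 0 ≤ (if 0 < W j c then μ j c else 0)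
    split_ifs
    · exact h0 j c
    · exact le_rfl
  · intro j
    have h := Finset.sum_le_sum (fun c (_ : c ∈ Finset.univ) => hle j c)
    linarith [hγ j, h1 j]
  · intro c
    have h := Finset.sum_le_sum (fun j (_ : j ∈ Finset.univ) => hle j c)
    linarith [hσ c, h2 c]
end

section
/- Suppose (μ, γ, σ) is an optimal solution of problem (T), i.e., it is feasible for (T) and its (T)-objective value is ≥ that of every feasible triple. Then the matrix μ' defined by μ' j c = μ j c if W j c > 0 and μ' j c = 0 otherwise is an optimal solution of problem (W), i.e., μ' is feasible for (W) and ∑_{j,c} W j c * μ' j c ≥ ∑_{j,c} W j c * ν j c for every matrix ν feasible for (W). -/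
theorem slack_aux (A B : ℝ) (hA : 0 ≤ A) (hB : 0 ≤ B) :
    A - A * (B / max A B) = max (A - B) 0 := by
  rcases le_total A B with h | h
  · rw [max_eq_right h, max_eq_right (by linarith)]
    rcases hB.eq_or_lt with h0 | h0
    · have : A = 0 := by linarith
      simp [this]
    · rw [div_self h0.ne']; ring
  · rw [max_eq_left h, max_eq_left (by linarith)]
    rcases hA.eq_or_lt with h0 | h0
    · have : B = 0 := by linarith
      simp [this]
    · rw [mul_div_cancel₀ _ h0.ne']

theorem exists_feasT (n m : ℕ) (κ : Fin n → ℝ) (Q : Fin m → ℝ) (ν : Fin n → Fin m → ℝ)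
    (h : FeasW n m κ Q ν) :
    ∃ ν' γ' σ', FeasT n m κ Q ν' γ' σ' ∧ ∀ j c, ν j c ≤ ν' j c := by
  obtain ⟨h0, h1, h2⟩ := h
  obtain ⟨a, ha⟩ : ∃ a : Fin n → ℝ, ∀ j, a j = κ j - ∑ c, ν j c := ⟨_, fun _ => rfl⟩
  obtain ⟨b, hb⟩ : ∃ b : Fin m → ℝ, ∀ c, b c = Q c - ∑ j, ν j c := ⟨_, fun _ => rfl⟩
  have ha0 : ∀ j, 0 ≤ a j := fun j => by rw [ha]; linarith [h1 j]
  have hb0 : ∀ c, 0 ≤ b c := fun c => by rw [hb]; linarith [h2 c]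
  obtain ⟨A, hA⟩ : ∃ A, A = ∑ j, a j := ⟨_, rfl⟩
  obtain ⟨B, hB⟩ : ∃ B, B = ∑ c, b c := ⟨_, rfl⟩
  have hA0 : 0 ≤ A := hA ▸ Finset.sum_nonneg fun j _ => ha0 j
  have hB0 : 0 ≤ B := hB ▸ Finset.sum_nonneg fun c _ => hb0 c
  have hM0 : 0 ≤ max A B := le_max_of_le_left hA0
  have hAB : A - B = ∑ j, κ j - ∑ c, Q c := by
    rw [hA, hB]
    simp only [ha, hb, Finset.sum_sub_distrib]
    rw [Finset.sum_comm (f := fun c j => ν j c)]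
    ring
  have hBA : B - A = ∑ c, Q c - ∑ j, κ j := by linarith
  have hAM : A / max A B ≤ 1 := div_le_one_of_le₀ (le_max_left _ _) hM0
  have hBM : B / max A B ≤ 1 := div_le_one_of_le₀ (le_max_right _ _) hM0
  have hd : ∀ j c, 0 ≤ a j * b c / max A B := fun j c =>
    div_nonneg (mul_nonneg (ha0 j) (hb0 c)) hM0
  refine ⟨fun j c => ν j c + a j * b c / max A B, fun j => a j - a j * (B / max A B),
    fun c => b c - b c * (A / max A B), ⟨?_, ?_, ?_, ?_, ?_, ?_, ?_⟩, ?_⟩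
  · exact fun j c => add_nonneg (h0 j c) (hd j c)
  · intro j
    nlinarith [ha0 j]
  · intro c
    nlinarith [hb0 c]
  · intro j
    simp only [Finset.sum_add_distrib, ← Finset.sum_div, ← Finset.mul_sum, ← hB]
    linarith [ha j, mul_div_assoc (a j) B (max A B)]
  · rw [← hAB, Finset.sum_sub_distrib, ← Finset.sum_mul, ← hA, slack_aux A B hA0 hB0]
  · intro c
    simp only [Finset.sum_add_distrib, ← Finset.sum_div, ← Finset.sum_mul, ← hA]
    rw [mul_comm A, mul_div_assoc]
    linarith [hb c]
  · rw [← hBA, Finset.sum_sub_distrib, ← Finset.sum_mul, ← hB, max_comm A B,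
      slack_aux B A hB0 hA0]
  · exact fun j c => le_add_of_nonneg_right (hd j c)

/-- Theorem 2 of the paper: if `(μ, γ, σ)` is an optimal solution of the
optimal-transport problem (T), then the matrix obtained from `μ` by zeroing out the
entries with nonpositive weight is an optimal solution of the scheduling problem (W). -/
theorem stmt_4 (n m : ℕ) (W : Fin n → Fin m → ℝ) (κ : Fin n → ℝ) (Q : Fin m → ℝ)
    (hκ : ∀ j, 0 ≤ κ j) (hQ : ∀ c, 0 ≤ Q c)
    (μ : Fin n → Fin m → ℝ) (γ : Fin n → ℝ) (σ : Fin m → ℝ)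
    (hfeas : FeasT n m κ Q μ γ σ)
    (hopt : ∀ (ν : Fin n → Fin m → ℝ) (γ' : Fin n → ℝ) (σ' : Fin m → ℝ),
      FeasT n m κ Q ν γ' σ' →
      ∑ j, ∑ c, max (W j c) 0 * ν j c ≤ ∑ j, ∑ c, max (W j c) 0 * μ j c) :
    FeasW n m κ Q (fun j c => if 0 < W j c then μ j c else 0) ∧
    ∀ ν : Fin n → Fin m → ℝ, FeasW n m κ Q ν →
      ∑ j, ∑ c, W j c * ν j c ≤
        ∑ j, ∑ c, W j c * (if 0 < W j c then μ j c else 0) := by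
  obtain ⟨f0, f1, f2, f3, -, f5, -⟩ := hfeas
  have hle : ∀ j c, (if 0 < W j c then μ j c else 0) ≤ μ j c := by
    intro j c
    split_ifs
    · exact le_rfl
    · exact f0 j c
  refine ⟨⟨?_, ?_, ?_⟩, ?_⟩
  · intro j c
    dsimp only
    split_ifs
    · exact f0 j c
    · exact le_rfl
  · intro j
    have := Finset.sum_le_sum fun c (_ : c ∈ Finset.univ) => hle j c
    linarith [f3 j, f1 j]
  · intro c
    have := Finset.sum_le_sum fun j (_ : j ∈ Finset.univ) => hle j c
    linarith [f5 c, f2 c]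
  · intro ν hν
    obtain ⟨ν', γ', σ', hT, hνν⟩ := exists_feasT n m κ Q ν hν
    calc ∑ j, ∑ c, W j c * ν j c ≤ ∑ j, ∑ c, max (W j c) 0 * ν' j c :=
          Finset.sum_le_sum fun j _ => Finset.sum_le_sum fun c _ =>
            mul_le_mul (le_max_left _ _) (hνν j c) (hν.1 j c) (le_max_right _ _)
      _ ≤ ∑ j, ∑ c, max (W j c) 0 * μ j c := hopt ν' γ' σ' hT
      _ = _ := by
          refine Finset.sum_congr rfl fun j _ => Finset.sum_congr rfl fun c _ => ?_
          split_ifs with h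
          · rw [max_eq_left h.le]
          · rw [max_eq_right (not_lt.mp h)]; ring
end

section
/- Fix n m : ℕ with n ≥ 1, weights W : Fin n → Fin m → ℝ, queues Q : Fin m → ℝ with Q c ≥ 0 for all c, and capacities κ : Fin n → ℝ with κ j ≥ 0 for all j. Let a : Fin n → Fin m be any selection with W j (a j) = max_c W j c for all j. Define ψ j c = min( (exp(W j c) / ∑_{j'} exp(W j' c)) * Q c , κ j ) and μ j c = ψ j c if c = a j, and μ j c = 0 otherwise. Then μ is feasible for problem (W): μ j c ≥ 0 for all j,c; ∑_c μ j c ≤ κ j for all j; and ∑_j μ j c ≤ Q c for all c. -/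
/-- The softmax-based max-weight variant of Appendix D of the paper is always feasible
for the scheduling problem (W). -/
theorem stmt_14 (n m : ℕ) (hn : 1 ≤ n)
    (W : Fin n → Fin m → ℝ) (Q : Fin m → ℝ) (κ : Fin n → ℝ)
    (hQ : ∀ c, 0 ≤ Q c) (hκ : ∀ j, 0 ≤ κ j)
    (a : Fin n → Fin m)
    (ha : ∀ j, W j (a j) =
      Finset.univ.sup' ⟨a ⟨0, hn⟩, Finset.mem_univ _⟩ (W j)) :
    FeasW n m κ Q (fun j c =>
      if c = a j then
        min ((Real.exp (W j c) / ∑ j', Real.exp (W j' c)) * Q c) (κ j)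
      else 0) := by
  have hq : ∀ j c, 0 ≤ (Real.exp (W j c) / ∑ j', Real.exp (W j' c)) * Q c := fun j c =>
    mul_nonneg (div_nonneg (Real.exp_pos _).le
      (Finset.sum_nonneg fun _ _ => (Real.exp_pos _).le)) (hQ c)
  refine ⟨fun j c => ?_, fun j => ?_, fun c => ?_⟩
  · dsimp only
    split_ifs
    · exact le_min (hq j c) (hκ j)
    · exact le_rfl
  · dsimp only
    rw [Finset.sum_ite_eq' Finset.univ (a j)]
    simp
  · have hpos : 0 < ∑ j', Real.exp (W j' c) :=
      Finset.sum_pos (fun _ _ => Real.exp_pos _) ⟨⟨0, hn⟩, Finset.mem_univ _⟩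
    calc _ ≤ ∑ j, (Real.exp (W j c) / ∑ j', Real.exp (W j' c)) * Q c := by
          refine Finset.sum_le_sum fun j _ => ?_
          dsimp only
          split_ifs
          · exact min_le_left _ _
          · exact hq j c
      _ = Q c := by
          rw [← Finset.sum_mul, ← Finset.sum_div, div_self hpos.ne', one_mul]
end
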